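/- The function x ↦ (3x³ − 6i·x² − 11x + 4i)/((x − i)⁵·(x + i)³), viewed as a map from ℝ to ℂ, is integrable on ℝ, and its integral over ℝ equals −25πi/16. (This is the normal-direction integral arising from the trace expression tr[T₂ × ∂_{ξ_n}σ_{−3}] in equations (3.80) and (5.28) of case (c).) -/

import Mathlib

open Complex MeasureTheory

/-- The integrand in terms of `T = I / (x - I)` and `S = I / (x + I)`. -/
lemma integrand_eq (z : ℂ) (h₁ : z - I ≠ 0) (h₂ : z + I ≠ 0) :
    (3 * z ^ 3 - 6 * I * z ^ 2 - 11 * z + 4 * I) / ((z - I) ^ 5 * (z + I) ^ 3) =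
      -I * (I / (z - I)) ^ 2 * (I / (z + I)) ^ 3 *
        (4 * (I / (z - I)) ^ 3 + 8 * (I / (z - I)) ^ 2 + 3 * (I / (z - I)) + 3) := by
  have hI : I ^ 2 = -1 := I_sq
  have h3 : I ^ 3 = -I := I_pow_three
  field_simp
  simp only [show I ^ 6 = -1 by linear_combination (I ^ 4 - I ^ 2 + 1) * hI]
  ring_nf
  simp only [hI, h3]
  ring

lemma ofReal_sub_I_ne_zero (x : ℝ) : (x : ℂ) - I ≠ 0 := by
  intro h
  simpa using congrArg Complex.im h

lemma ofReal_add_I_ne_zero (x : ℝ) : (x : ℂ) + I ≠ 0 := by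
  intro h
  simpa using congrArg Complex.im h

lemma norm_I_div_ofReal_sub_I_sq (x : ℝ) : ‖I / ((x : ℂ) - I)‖ ^ 2 = (1 + x ^ 2)⁻¹ := by
  rw [norm_div, norm_I, div_pow, Complex.sq_norm, normSq_apply]
  simp
  ring

lemma norm_I_div_ofReal_add_I_sq (x : ℝ) : ‖I / ((x : ℂ) + I)‖ ^ 2 = (1 + x ^ 2)⁻¹ := by
  rw [norm_div, norm_I, div_pow, Complex.sq_norm, normSq_apply]
  simp
  ring

lemma norm_le_one_of_sq_eq {z : ℂ} {x : ℝ} (h : ‖z‖ ^ 2 = (1 + x ^ 2)⁻¹) : ‖z‖ ≤ 1 := by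
  have : (1 + x ^ 2)⁻¹ ≤ 1 := inv_le_one_of_one_le₀ (by nlinarith [sq_nonneg x])
  nlinarith [norm_nonneg z]

lemma hasDerivAt_I_div_add (c : ℂ) (x : ℝ) (h : (x : ℂ) + c ≠ 0) :
    HasDerivAt (fun y : ℝ => I / ((y : ℂ) + c)) (I * (I / ((x : ℂ) + c)) ^ 2) x := by
  have hd : HasDerivAt (fun y : ℝ => (y : ℂ) + c) 1 x :=
    (HasDerivAt.ofReal_comp (hasDerivAt_id x)).add_const c
  refine ((hasDerivAt_const x I).div hd h).congr_deriv ?_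
  rw [div_pow, I_sq]
  ring

lemma tendsto_I_div_ofReal_add (c : ℂ) {l : Filter ℝ}
    (hl : Filter.Tendsto (fun x : ℝ => ‖(x : ℂ)‖) l Filter.atTop) :
    Filter.Tendsto (fun x : ℝ => I / ((x : ℂ) + c)) l (nhds 0) := by
  have h : Filter.Tendsto (fun x : ℝ => (x : ℂ) + c) l (Bornology.cobounded ℂ) := by
    rw [← tendsto_norm_atTop_iff_cobounded]
    refine Filter.tendsto_atTop_mono (fun x => ?_)
      (Filter.tendsto_atTop_add_const_right l (-‖c‖) hl)
    have := norm_sub_norm_le (x : ℂ) (-c)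
    simpa [sub_eq_add_neg] using this
  simpa [div_eq_mul_inv] using (Filter.tendsto_inv₀_cobounded.comp h).const_mul I

/-- The rational part of the antiderivative, in terms of `T = I / (x - I)`, `S = I / (x + I)`. -/
noncomputable def rationalPart (T S : ℂ) : ℂ :=
  -(T ^ 4 / 8 + T ^ 3 / 12 - 3 / 16 * T ^ 2 + 11 / 16 * T + 3 / 8 * S ^ 2 + 7 / 8 * S)

lemma tendsto_antiderivative {l : Filter ℝ} {a : ℝ}
    (hl : Filter.Tendsto (fun x : ℝ => ‖(x : ℂ)‖) l Filter.atTop)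
    (ha : Filter.Tendsto Real.arctan l (nhds a)) :
    Filter.Tendsto (fun x : ℝ => rationalPart (I / ((x : ℂ) + -I)) (I / ((x : ℂ) + I)) +
      -(25 * I / 16) * (Real.arctan x : ℂ)) l (nhds (-(25 * I / 16) * (a : ℂ))) := by
  have hc : Continuous fun p : ℂ × ℂ => rationalPart p.1 p.2 := by
    unfold rationalPart
    fun_prop
  have h := (hc.tendsto (0, 0)).comp
    ((tendsto_I_div_ofReal_add (-I) hl).prodMk_nhds (tendsto_I_div_ofReal_add I hl))
  have h' := h.add (((continuous_ofReal.tendsto a).comp ha).const_mul (-(25 * I / 16)))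
  simpa [rationalPart, Function.comp_def] using h'

lemma hasDerivAt_antiderivative (x : ℝ) :
    HasDerivAt (fun x : ℝ => rationalPart (I / ((x : ℂ) + -I)) (I / ((x : ℂ) + I)) +
      -(25 * I / 16) * (Real.arctan x : ℂ))
      ((3 * (x : ℂ) ^ 3 - 6 * I * (x : ℂ) ^ 2 - 11 * (x : ℂ) + 4 * I) /
        (((x : ℂ) - I) ^ 5 * ((x : ℂ) + I) ^ 3)) x := by
  have h₁ := ofReal_sub_I_ne_zero x
  have h₂ := ofReal_add_I_ne_zero x
  have hT := hasDerivAt_I_div_add (-I) x (by simpa [sub_eq_add_neg] using h₁)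
  have hS := hasDerivAt_I_div_add I x h₂
  have hA := (Real.hasDerivAt_arctan x).ofReal_comp.const_mul (-(25 * I / 16))
  have hd := ((((((hT.pow 4).div_const 8).add ((hT.pow 3).div_const 12)).sub
    ((hT.pow 2).const_mul (3 / 16))).add (hT.const_mul (11 / 16))).add
    ((hS.pow 2).const_mul (3 / 8))).add (hS.const_mul (7 / 8))
  refine (hd.neg.add hA).congr_deriv ?_
  rw [integrand_eq _ h₁ h₂, ← sub_eq_add_neg]
  have hTS : I / ((x : ℂ) - I) - I / ((x : ℂ) + I) =
      2 * (I / ((x : ℂ) - I)) * (I / ((x : ℂ) + I)) := by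
    field_simp
    ring
  have harctan : (((1 / (1 + x ^ 2) : ℝ)) : ℂ) = -(I / ((x : ℂ) - I)) * (I / ((x : ℂ) + I)) := by
    have h₃ : ((x : ℂ) - I) * ((x : ℂ) + I) = 1 + (x : ℂ) ^ 2 := by
      linear_combination -I_sq
    push_cast
    rw [← h₃]
    field_simp
    linear_combination I_sq
  rw [harctan]
  generalize I / ((x : ℂ) - I) = T at *
  generalize I / ((x : ℂ) + I) = S at *
  push_cast
  linear_combination I * (-2 * T ^ 4 * S ^ 2 - T ^ 4 * S - 3 * T ^ 3 * S ^ 2 - T ^ 4 / 2 - T ^ 3 * S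
    - T ^ 3 / 4 + T ^ 2 * S / 2 - 3 / 2 * T * S ^ 2 + 3 / 8 * T ^ 2 - T * S + 3 / 4 * S ^ 2
    - 11 / 16 * T + 7 / 8 * S) * hTS

theorem stmt_9 :
    MeasureTheory.Integrable
      (fun x : ℝ => (3 * (x : ℂ)^3 - 6 * I * (x : ℂ)^2 - 11 * (x : ℂ) + 4 * I) / (((x : ℂ) - I) ^ 5 * ((x : ℂ) + I) ^ 3)) ∧
    ∫ x : ℝ, (3 * (x : ℂ)^3 - 6 * I * (x : ℂ)^2 - 11 * (x : ℂ) + 4 * I) / (((x : ℂ) - I) ^ 5 * ((x : ℂ) + I) ^ 3) = -(25 * (Real.pi : ℂ) * I / 16) := by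
  have hint : Integrable (fun x : ℝ => (3 * (x : ℂ)^3 - 6 * I * (x : ℂ)^2 - 11 * (x : ℂ) + 4 * I) /
      (((x : ℂ) - I) ^ 5 * ((x : ℂ) + I) ^ 3)) := by
    refine (integrable_inv_one_add_sq.const_mul 18).mono' ?_ (Filter.Eventually.of_forall ?_)
    · refine Continuous.aestronglyMeasurable (Continuous.div (by fun_prop) (by fun_prop) ?_)
      exact fun x => mul_ne_zero (pow_ne_zero _ (ofReal_sub_I_ne_zero x))
        (pow_ne_zero _ (ofReal_add_I_ne_zero x))
    · intro x
      have hT := norm_I_div_ofReal_sub_I_sq x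
      have hT₁ := norm_le_one_of_sq_eq hT
      have hS₁ := norm_le_one_of_sq_eq (norm_I_div_ofReal_add_I_sq x)
      rw [integrand_eq _ (ofReal_sub_I_ne_zero x) (ofReal_add_I_ne_zero x), ← hT]
      generalize I / ((x : ℂ) - I) = T at *
      generalize I / ((x : ℂ) + I) = S at *
      have hP : ‖4 * T ^ 3 + 8 * T ^ 2 + 3 * T + 3‖ ≤ 18 := by
        calc ‖4 * T ^ 3 + 8 * T ^ 2 + 3 * T + 3‖
            ≤ ‖4 * T ^ 3‖ + ‖8 * T ^ 2‖ + ‖3 * T‖ + ‖(3 : ℂ)‖ := norm_add₄_le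
          _ = 4 * ‖T‖ ^ 3 + 8 * ‖T‖ ^ 2 + 3 * ‖T‖ + 3 := by simp
          _ ≤ 4 * 1 ^ 3 + 8 * 1 ^ 2 + 3 * 1 + 3 := by gcongr
          _ = 18 := by norm_num
      calc ‖-I * T ^ 2 * S ^ 3 * (4 * T ^ 3 + 8 * T ^ 2 + 3 * T + 3)‖
          = ‖T‖ ^ 2 * ‖S‖ ^ 3 * ‖4 * T ^ 3 + 8 * T ^ 2 + 3 * T + 3‖ := by simp
        _ ≤ ‖T‖ ^ 2 * 1 ^ 3 * 18 := by gcongr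
        _ = 18 * ‖T‖ ^ 2 := by ring
  refine ⟨hint, ?_⟩
  have hbot : Filter.Tendsto (fun x : ℝ => ‖(x : ℂ)‖) Filter.atBot Filter.atTop := by
    simpa using Filter.tendsto_abs_atBot_atTop (G := ℝ)
  have htop : Filter.Tendsto (fun x : ℝ => ‖(x : ℂ)‖) Filter.atTop Filter.atTop := by
    simpa using Filter.tendsto_abs_atTop_atTop (G := ℝ)
  rw [integral_of_hasDerivAt_of_tendsto hasDerivAt_antiderivative hint
    (tendsto_antiderivative hbot (Real.tendsto_arctan_atBot.mono_right nhdsWithin_le_nhds))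
    (tendsto_antiderivative htop (Real.tendsto_arctan_atTop.mono_right nhdsWithin_le_nhds))]
  push_cast
  ring
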